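/- After removing the directed edge a⋆ → b, for every a ∈ nd(b) and every c ∈ de(b) with c ≠ b one has Σ⋆ a c = Σ a c − Σ a a⋆ · λ · (P b c), where P = (1 − Λ)⁻¹. -/

import Mathlib

open Matrix

attribute [local instance] Classical.propDecidable

namespace EdgeIntervention

variable {n : ℕ}

/-- Descendants of `b` (including `b`): vertices reachable under the edge relation of `D`. -/
def desc (D : Set (Fin n × Fin n)) (b : Fin n) : Set (Fin n) :=
  {c | Relation.ReflTransGen (fun i j => (i, j) ∈ D) b c}

/-- Ancestors of `c` (including `c`). -/
def anc (D : Set (Fin n × Fin n)) (c : Fin n) : Set (Fin n) :=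
  {i | c ∈ desc D i}

/-- Descendants of `b` in the induced subgraph on `W`. -/
def descW (D : Set (Fin n × Fin n)) (W : Set (Fin n)) (b : Fin n) : Set (Fin n) :=
  {c | Relation.ReflTransGen (fun i j => (i, j) ∈ D ∧ i ∈ W ∧ j ∈ W) b c}

/-- District of `b` in the induced subgraph on `W`. -/
def disW (B : Set (Fin n × Fin n)) (W : Set (Fin n)) (b : Fin n) : Set (Fin n) :=
  {c | Relation.ReflTransGen (fun i j => (i, j) ∈ B ∧ i ∈ W ∧ j ∈ W) b c}

/-- Markov blanket of `b` in the induced subgraph on `W`. -/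
def mbW (D B : Set (Fin n × Fin n)) (W : Set (Fin n)) (b : Fin n) : Set (Fin n) :=
  (disW B W b ∪ {i | i ∈ W ∧ ∃ d ∈ disW B W b, (i, d) ∈ D}) \ {b}

/-- `Λ` is supported on the directed edge set `D`. -/
def DSupported (D : Set (Fin n × Fin n)) (Λ : Matrix (Fin n) (Fin n) ℝ) : Prop :=
  ∀ i j, (i, j) ∉ D → Λ i j = 0

/-- `Ω` is compatible with the bidirected edge set `B`: symmetric, positive definite,
and vanishing off the diagonal and off `B`. -/
def BCompatible (B : Set (Fin n × Fin n)) (Ω : Matrix (Fin n) (Fin n) ℝ) : Prop :=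
  Ω.IsSymm ∧ Ω.PosDef ∧ ∀ i j, i ≠ j → (i, j) ∉ B → Ω i j = 0

/-- The covariance matrix `Σ = ((1 - Λ)⁻¹)ᵀ * Ω * (1 - Λ)⁻¹` of the linear SEM. -/
noncomputable def cov (Λ Ω : Matrix (Fin n) (Fin n) ℝ) : Matrix (Fin n) (Fin n) ℝ :=
  ((1 - Λ)⁻¹)ᵀ * Ω * (1 - Λ)⁻¹

/-- Sum over all directed paths from `i` to `j` of their weights.  A path with `k` edges is
encoded as `f : Fin (k+1) → Fin n` with all steps in `D`; since edges strictly increase,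
every directed path has at most `n` edges, so `k` ranges over `Finset.range (n+1)`. -/
noncomputable def pathSum (D : Set (Fin n × Fin n)) (Λ : Matrix (Fin n) (Fin n) ℝ)
    (i j : Fin n) : ℝ :=
  ∑ k ∈ Finset.range (n + 1),
    ∑ f ∈ Finset.univ.filter
        (fun f : Fin (k + 1) → Fin n =>
          f 0 = i ∧ f (Fin.last k) = j ∧ ∀ t : Fin k, (f t.castSucc, f t.succ) ∈ D),
      ∏ t : Fin k, Λ (f t.castSucc) (f t.succ)

/-- Conditional covariance `σ_{vw·S} = Σ v w − Σ_{vS} (Σ_{SS})⁻¹ Σ_{Sw}`. -/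
noncomputable def condCov (Cov : Matrix (Fin n) (Fin n) ℝ) (S : Set (Fin n))
    (v w : Fin n) : ℝ :=
  letI := (Set.toFinite S).fintype
  Cov v w - ∑ i : S, ∑ j : S,
    Cov v i.val * (Cov.submatrix (Subtype.val : S → Fin n) Subtype.val)⁻¹ i j * Cov j.val w

/-- Regression coefficient `β_{vw·S} = σ_{vw·S} / σ_{vv·S}`. -/
noncomputable def regCoef (Cov : Matrix (Fin n) (Fin n) ℝ) (S : Set (Fin n))
    (v w : Fin n) : ℝ :=
  condCov Cov S v w / condCov Cov S v v

/-- The matrix obtained from `Λ` by setting the `(a,b)` entry to `0`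
(removal of the directed edge `a → b`). -/
def removeEdge (Λ : Matrix (Fin n) (Fin n) ℝ) (a b : Fin n) : Matrix (Fin n) (Fin n) ℝ :=
  Matrix.of fun i j => if i = a ∧ j = b then 0 else Λ i j

/-- The matrix obtained from `Ω` by setting the `(a,b)` and `(b,a)` entries to `0`
(removal of the bidirected edge `a ↔ b`). -/
def removeBi (Ω : Matrix (Fin n) (Fin n) ℝ) (a b : Fin n) : Matrix (Fin n) (Fin n) ℝ :=
  Matrix.of fun i j => if (i = a ∧ j = b) ∨ (i = b ∧ j = a) then 0 else Ω i j

theorem isUnit_det_one_sub {D : Set (Fin n × Fin n)} (hD : ∀ i j : Fin n, (i, j) ∈ D → i < j)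
    {Λ : Matrix (Fin n) (Fin n) ℝ} (hΛ : DSupported D Λ) : IsUnit (1 - Λ).det := by
  have hzero : ∀ i j : Fin n, j ≤ i → Λ i j = 0 := fun i j hji =>
    hΛ i j fun h => absurd (hD i j h) (not_lt.mpr hji)
  have htri : (1 - Λ).BlockTriangular id := by
    intro i j hji
    have hji : j < i := hji
    simp [hzero i j hji.le, Matrix.one_apply_ne hji.ne']
  rw [Matrix.det_of_isUpperTriangular htri]
  simp [hzero _ _ le_rfl]

theorem inv_one_sub_apply_eq_zero {D : Set (Fin n × Fin n)}
    (hD : ∀ i j : Fin n, (i, j) ∈ D → i < j)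
    {Λ : Matrix (Fin n) (Fin n) ℝ} (hΛ : DSupported D Λ) (b a : Fin n) (ha : a ∉ desc D b) :
    (1 - Λ)⁻¹ b a = 0 := by
  have hP : (1 - Λ)⁻¹ = 1 + (1 - Λ)⁻¹ * Λ := by
    have h := Matrix.nonsing_inv_mul _ (isUnit_det_one_sub hD hΛ)
    rw [mul_sub, mul_one] at h
    exact sub_eq_iff_eq_add.mp h
  induction a using WellFoundedLT.induction with
  | ind a ih =>
    have hba : b ≠ a := fun h => ha (h ▸ Relation.ReflTransGen.refl)
    rw [hP, Matrix.add_apply, Matrix.one_apply_ne hba, zero_add, Matrix.mul_apply]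
    refine Finset.sum_eq_zero fun k _ => ?_
    by_cases hk : (k, a) ∈ D
    · rw [ih k (hD k a hk) fun h => ha (Relation.ReflTransGen.tail h hk), zero_mul]
    · rw [hΛ k a hk, mul_zero]

theorem le_of_mem_desc {D : Set (Fin n × Fin n)} (hD : ∀ i j : Fin n, (i, j) ∈ D → i < j)
    {b c : Fin n} (hc : c ∈ desc D b) : b ≤ c := by
  induction hc with
  | refl => exact le_rfl
  | tail _ h ih => exact ih.trans (hD _ _ h).le

theorem DSupported.removeEdge {D : Set (Fin n × Fin n)} {Λ : Matrix (Fin n) (Fin n) ℝ}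
    (hΛ : DSupported D Λ) (a b : Fin n) : DSupported D (removeEdge Λ a b) := by
  intro i j hij
  simp [EdgeIntervention.removeEdge, hΛ i j hij]

theorem removeEdge_eq_sub_single (Λ : Matrix (Fin n) (Fin n) ℝ) (a b : Fin n) :
    removeEdge Λ a b = Λ - Matrix.single a b (Λ a b) := by
  ext i j
  by_cases h : i = a ∧ j = b
  · obtain ⟨rfl, rfl⟩ := h
    simp [removeEdge]
  · have h' : ¬(a = i ∧ b = j) := fun ⟨h₁, h₂⟩ => h ⟨h₁.symm, h₂.symm⟩
    simp [removeEdge, h, h']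

/-- Removing `a → b` is a rank-one update of the total-effect matrix `(1 - Λ)⁻¹`. -/
theorem inv_one_sub_removeEdge_apply {D : Set (Fin n × Fin n)}
    (hD : ∀ i j : Fin n, (i, j) ∈ D → i < j)
    {Λ : Matrix (Fin n) (Fin n) ℝ} (hΛ : DSupported D Λ) {a b : Fin n} (hab : (a, b) ∈ D)
    (i j : Fin n) :
    (1 - removeEdge Λ a b)⁻¹ i j
      = (1 - Λ)⁻¹ i j - (1 - Λ)⁻¹ i a * Λ a b * (1 - Λ)⁻¹ b j := by
  have hstar := Matrix.nonsing_inv_mul _ (isUnit_det_one_sub hD (hΛ.removeEdge a b))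
  have hP := Matrix.mul_nonsing_inv _ (isUnit_det_one_sub hD hΛ)
  have hres : (1 - removeEdge Λ a b)⁻¹
      = (1 - Λ)⁻¹ - (1 - removeEdge Λ a b)⁻¹ * Matrix.single a b (Λ a b) * (1 - Λ)⁻¹ := by
    have hsplit : 1 - removeEdge Λ a b = (1 - Λ) + Matrix.single a b (Λ a b) := by
      rw [removeEdge_eq_sub_single]
      abel
    have h : (1 - removeEdge Λ a b)⁻¹ * ((1 - Λ) + Matrix.single a b (Λ a b)) * (1 - Λ)⁻¹
        = (1 - Λ)⁻¹ := by
      rw [← hsplit, hstar, one_mul]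
    rw [mul_add, add_mul, Matrix.mul_assoc _ (1 - Λ), hP, mul_one] at h
    exact eq_sub_of_add_eq h
  have hentry : ∀ k l : Fin n, (1 - removeEdge Λ a b)⁻¹ k l
      = (1 - Λ)⁻¹ k l - (1 - removeEdge Λ a b)⁻¹ k a * Λ a b * (1 - Λ)⁻¹ b l := by
    intro k l
    conv_lhs => rw [hres]
    rw [Matrix.sub_apply, Matrix.mul_apply, Finset.sum_eq_single b]
    · rw [Matrix.mul_single_apply_same]
    · intro m _ hm
      rw [Matrix.mul_single_apply_of_ne _ _ _ _ _ hm, zero_mul]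
    · simp
  have hba : (1 - Λ)⁻¹ b a = 0 := inv_one_sub_apply_eq_zero hD hΛ b a fun h =>
    absurd (hD a b hab) (not_lt.mpr (le_of_mem_desc hD h))
  have hcol : (1 - removeEdge Λ a b)⁻¹ i a = (1 - Λ)⁻¹ i a := by
    rw [hentry i a, hba, mul_zero, sub_zero]
  rw [hentry i j, hcol]

/-- after removing the directed edge `a⋆ → b`, for every `a ∈ nd(b)` and every
`c ∈ de(b)` with `c ≠ b`, `Σ⋆ a c = Σ a c − Σ a a⋆ · λ · (P b c)` with `P = (1 − Λ)⁻¹`. -/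
theorem remove_edge_cov_a_c (n : ℕ) (D B : Set (Fin n × Fin n))
    (hD : ∀ i j : Fin n, (i, j) ∈ D → i < j)
    (hBsymm : ∀ i j : Fin n, (i, j) ∈ B → (j, i) ∈ B)
    (hBirr : ∀ i : Fin n, (i, i) ∉ B)
    (Λ Ω : Matrix (Fin n) (Fin n) ℝ)
    (hΛ : DSupported D Λ) (hΩ : BCompatible B Ω)
    (astar b : Fin n) (hab : (astar, b) ∈ D) :
    ∀ a c : Fin n, a ∉ desc D b → c ∈ desc D b → c ≠ b →
      cov (removeEdge Λ astar b) Ω a c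
        = cov Λ Ω a c - cov Λ Ω a astar * Λ astar b * (1 - Λ)⁻¹ b c := by
  intro a c ha _ _
  have hba := inv_one_sub_apply_eq_zero hD hΛ b a ha
  simp only [cov, Matrix.mul_apply (M := _ * Ω), Matrix.mul_apply (N := Ω),
    Matrix.transpose_apply, inv_one_sub_removeEdge_apply hD hΛ hab, hba, mul_zero, sub_zero,
    mul_sub, Finset.sum_sub_distrib, Finset.sum_mul _ _ (Λ astar b),
    Finset.sum_mul _ _ ((1 - Λ)⁻¹ b c), mul_assoc]

end EdgeIntervention
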